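/- Let ℓ > 1 be an integer, G a finite group, δ > 0, and d ≥ 1 an integer. Suppose that for every ε > 0 there is a constant C > 0 with |Cl_F[ℓ]| ≤ C · Disc(F)^{1/2 − δ + ε} for every Galois number field F over ℚ with Gal(F/ℚ) ≅ G. Then for every ε > 0 there is a constant C' > 0 such that for every tower of number fields ℚ ⊆ F ⊆ L with [L : ℚ] = d and F/ℚ Galois with Gal(F/ℚ) ≅ G, one has |Cl_L[ℓ]| ≤ C' · Disc(L)^{1/2 + ε} · Disc(F)^{−δ}. -/

import Mathlib

open NumberField

/-- The number of `ℓ`-torsion elements in the class group of a number field `F`. -/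
noncomputable def ellTorsion (F : Type*) [Field F] [NumberField F] (ℓ : ℕ) : ℕ :=
  Nat.card {x : ClassGroup (𝓞 F) // x ^ ℓ = 1}

theorem ncard_primesOver_span_le_finrank (K : Type*) [Field K] [NumberField K] {p : ℕ}
    (hp : p.Prime) :
    ((Ideal.span {(p : ℤ)}).primesOver (𝓞 K)).Finite ∧
    ((Ideal.span {(p : ℤ)}).primesOver (𝓞 K)).ncard ≤ Module.finrank ℚ K := by
  have hp' : Prime (p : ℤ) := Nat.prime_iff_prime_int.mp hp
  have : (Ideal.span {(p : ℤ)}).IsPrime :=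
    (Ideal.span_singleton_prime hp'.ne_zero).mpr hp'
  have : (Ideal.span {(p : ℤ)}).IsMaximal :=
    this.isMaximal (by simpa using hp'.ne_zero)
  have hfin : ((Ideal.span {(p : ℤ)}).primesOver (𝓞 K)).Finite :=
    IsDedekindDomain.primesOver_finite _ _
  refine ⟨hfin, ?_⟩
  have : Fintype ((Ideal.span {(p : ℤ)}).primesOver (𝓞 K)) := hfin.fintype
  rw [← RingOfIntegers.rank K,
    ← Ideal.sum_ramification_inertia_eq_finrank (Ideal.span {(p : ℤ)}) (𝓞 K),
    ← Nat.card_coe_set_eq, Nat.card_eq_fintype_card, ← Finset.card_univ, Finset.card_eq_sum_ones]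
  refine Finset.sum_le_sum fun q _ => ?_
  have : q.1.IsPrime := q.2.1
  exact Nat.mul_pos (Ideal.ramificationIdx_pos _ _) (Ideal.inertiaDeg_pos _ _)

theorem ncard_prime_absNorm_le (K : Type*) [Field K] [NumberField K] (B : ℕ) :
    {P : Ideal (𝓞 K) | Prime P ∧ Ideal.absNorm P ≤ B}.Finite ∧
    {P : Ideal (𝓞 K) | Prime P ∧ Ideal.absNorm P ≤ B}.ncard ≤ (B + 1) * Module.finrank ℚ K := by
  classical
  have hsub : {P : Ideal (𝓞 K) | Prime P ∧ Ideal.absNorm P ≤ B} ⊆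
      ⋃ p ∈ (Finset.range (B + 1)).filter Nat.Prime,
        (Ideal.span {(p : ℤ)}).primesOver (𝓞 K) := by
    rintro P ⟨hP, hB⟩
    have hP0 : P ≠ ⊥ := hP.ne_zero
    have hPp : P.IsPrime := Ideal.isPrime_of_prime hP
    have hmem : ((Ideal.absNorm P : ℤ)) ∈ P.under ℤ := by
      simp [Ideal.under, Ideal.mem_comap, Ideal.absNorm_mem]
    have hn0 : Ideal.absNorm P ≠ 0 := by simpa [Ideal.absNorm_eq_zero_iff] using hP0
    obtain ⟨a, ha⟩ := (IsPrincipalIdealRing.principal (P.under ℤ))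
    have ha' : P.under ℤ = Ideal.span {((a.natAbs : ℕ) : ℤ)} := by
      rw [ha, Int.span_natAbs]
    rw [ha', Ideal.mem_span_singleton, Int.natCast_dvd_natCast] at hmem
    have ha0 : a.natAbs ≠ 0 := by
      rintro h; rw [h] at hmem; exact hn0 (Nat.eq_zero_of_zero_dvd hmem)
    have hpr : (P.under ℤ).IsPrime := inferInstance
    rw [ha', Ideal.span_singleton_prime (by exact_mod_cast ha0), ← Nat.prime_iff_prime_int] at hpr
    simp only [Set.mem_iUnion, Finset.mem_filter, Finset.mem_range]
    refine ⟨a.natAbs, ⟨?_, hpr⟩, hPp, ⟨ha'.symm⟩⟩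
    have := Nat.le_of_dvd (Nat.pos_of_ne_zero hn0) hmem
    omega
  have hfin : (⋃ p ∈ (Finset.range (B + 1)).filter Nat.Prime,
        (Ideal.span {(p : ℤ)}).primesOver (𝓞 K)).Finite := by
    refine Set.Finite.biUnion (Finset.finite_toSet _) fun p hp => ?_
    exact (ncard_primesOver_span_le_finrank K (Finset.mem_filter.mp hp).2).1
  refine ⟨hfin.subset hsub, (Set.ncard_le_ncard hsub hfin).trans ?_⟩
  refine (Finset.set_ncard_biUnion_le _ _).trans ?_
  refine (Finset.sum_le_card_nsmul _ _ _ fun p hp =>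
    (ncard_primesOver_span_le_finrank K (Finset.mem_filter.mp hp).2).2).trans ?_
  rw [smul_eq_mul]
  gcongr
  exact (Finset.card_filter_le _ _).trans (by simp)

theorem one_le_max_inv_mul_log (ε : ℝ) : (1 : ℝ) ≤ max 1 (1 / (ε * Real.log 2)) := le_max_left _ _

theorem natCast_add_one_le_mul_rpow {ε x : ℝ} (hε : 0 < ε) (hx : 2 ≤ x) (k : ℕ) :
    (k : ℝ) + 1 ≤ max 1 (1 / (ε * Real.log 2)) * x ^ (k * ε) := by
  have hl : 0 < ε * Real.log 2 := mul_pos hε (Real.log_pos one_lt_two)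
  have h1 : 1 + k * (ε * Real.log 2) ≤ x ^ (k * ε) := by
    calc 1 + k * (ε * Real.log 2) ≤ Real.exp (k * (ε * Real.log 2)) := by
          rw [add_comm]; exact Real.add_one_le_exp _
      _ = 2 ^ (k * ε) := by
          rw [Real.rpow_def_of_pos two_pos]; ring_nf
      _ ≤ x ^ (k * ε) := by gcongr
  have h2 : 1 ≤ max 1 (1 / (ε * Real.log 2)) * (ε * Real.log 2) := by
    calc 1 = (1 / (ε * Real.log 2)) * (ε * Real.log 2) := by field_simp
      _ ≤ _ := by gcongr; exact le_max_right _ _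
  have h3 := one_le_max_inv_mul_log ε
  calc (k : ℝ) + 1 ≤ max 1 (1 / (ε * Real.log 2)) * (1 + k * (ε * Real.log 2)) := by
        have : (0 : ℝ) ≤ k := k.cast_nonneg
        nlinarith
    _ ≤ _ := by gcongr

theorem natCast_add_one_le_rpow {ε x : ℝ} (hε : 0 < ε) (hx : 2 ^ (1 / ε) ≤ x) (k : ℕ) :
    (k : ℝ) + 1 ≤ x ^ (k * ε) := by
  calc (k : ℝ) + 1 ≤ 2 ^ k := by exact_mod_cast Nat.lt_two_pow_self
    _ = (2 ^ (1 / ε) : ℝ) ^ (k * ε) := by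
        rw [← Real.rpow_mul two_pos.le, ← Real.rpow_natCast]; congr 1; field_simp
    _ ≤ _ := by gcongr

/-- The number of divisors of a nonzero ideal `I` is `O(N(I) ^ ε)`, uniformly in number fields of
given degree. -/
theorem exists_ncard_dvd_ideal_le (d : ℕ) {ε : ℝ} (hε : 0 < ε) : ∃ C : ℝ, 0 < C ∧
    ∀ (K : Type*) [Field K] [NumberField K], Module.finrank ℚ K = d →
      ∀ I : Ideal (𝓞 K), I ≠ 0 →
        {A : Ideal (𝓞 K) | A ∣ I}.Finite ∧
        ({A : Ideal (𝓞 K) | A ∣ I}.ncard : ℝ) ≤ C * (Ideal.absNorm I : ℝ) ^ ε := by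
  classical
  set c : ℝ := max 1 (1 / (ε * Real.log 2)) with hc
  have hc1 : 1 ≤ c := one_le_max_inv_mul_log ε
  set B : ℕ := ⌈(2 : ℝ) ^ (1 / ε)⌉₊ with hB
  refine ⟨c ^ ((B + 1) * d), by positivity, ?_⟩
  rintro K _ _ rfl I hI
  set s := UniqueFactorizationMonoid.normalizedFactors I with hs
  have hsub : Set.MapsTo UniqueFactorizationMonoid.normalizedFactors
      {A : Ideal (𝓞 K) | A ∣ I} (Finset.Iic s : Finset (Multiset (Ideal (𝓞 K)))) := by
    intro A hA
    have hA0 : A ≠ 0 := ne_zero_of_dvd_ne_zero hI hA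
    simpa using
      (UniqueFactorizationMonoid.dvd_iff_normalizedFactors_le_normalizedFactors hA0 hI).mp hA
  have hinj : Set.InjOn UniqueFactorizationMonoid.normalizedFactors {A : Ideal (𝓞 K) | A ∣ I} := by
    intro A hA A' hA' h
    have hA0 : A ≠ 0 := ne_zero_of_dvd_ne_zero hI hA
    have hA0' : A' ≠ 0 := ne_zero_of_dvd_ne_zero hI hA'
    rw [← associated_iff_eq,
      UniqueFactorizationMonoid.associated_iff_normalizedFactors_eq_normalizedFactors hA0 hA0']
    exact h
  refine ⟨Set.Finite.of_finite_image ((Finset.finite_toSet _).subset hsub.image_subset) hinj, ?_⟩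
  have hcard : {A : Ideal (𝓞 K) | A ∣ I}.ncard ≤ ∏ P ∈ s.toFinset, (s.count P + 1) := by
    rw [← Multiset.card_Iic, ← Set.ncard_coe_finset]
    exact Set.ncard_le_ncard_of_injOn _ hsub hinj (Finset.finite_toSet _)
  have hnorm : (Ideal.absNorm I : ℝ) ^ ε =
      ∏ P ∈ s.toFinset, (Ideal.absNorm P : ℝ) ^ (s.count P * ε) := by
    have : I = s.prod := by
      rw [← associated_iff_eq]
      exact (UniqueFactorizationMonoid.prod_normalizedFactors hI).symm
    conv_lhs => rw [this]
    rw [map_multiset_prod, Finset.prod_multiset_map_count]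
    push_cast
    rw [← Real.finsetProd_rpow _ _ (fun _ _ => by positivity)]
    refine Finset.prod_congr rfl fun P _ => ?_
    rw [Real.rpow_mul (by positivity), Real.rpow_natCast]
  have hprime : ∀ P ∈ s.toFinset, Prime P := fun P hP =>
    UniqueFactorizationMonoid.prime_of_normalized_factor P (Multiset.mem_toFinset.mp hP)
  have hterm : ∀ P ∈ s.toFinset, ((s.count P + 1 : ℕ) : ℝ) ≤
      (if Ideal.absNorm P ≤ B then c else 1) * (Ideal.absNorm P : ℝ) ^ (s.count P * ε) := by
    intro P hP
    push_cast
    split_ifs with h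
    · refine natCast_add_one_le_mul_rpow hε ?_ _
      have h0 : Ideal.absNorm P ≠ 0 := by
        simpa [Ideal.absNorm_eq_zero_iff] using (hprime P hP).ne_zero
      have h1 : Ideal.absNorm P ≠ 1 := by
        rw [Ne, Ideal.absNorm_eq_one_iff]
        exact (Ideal.isPrime_of_prime (hprime P hP)).ne_top
      exact_mod_cast (by omega : 2 ≤ Ideal.absNorm P)
    · rw [one_mul]
      refine natCast_add_one_le_rpow hε ?_ _
      refine (Nat.le_ceil _).trans ?_
      exact_mod_cast (not_le.mp h).le
  obtain ⟨hfinP, hcardP⟩ := ncard_prime_absNorm_le K B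
  calc ({A : Ideal (𝓞 K) | A ∣ I}.ncard : ℝ) ≤ ∏ P ∈ s.toFinset, ((s.count P + 1 : ℕ) : ℝ) := by
        exact_mod_cast hcard
    _ ≤ ∏ P ∈ s.toFinset, ((if Ideal.absNorm P ≤ B then c else 1) *
          (Ideal.absNorm P : ℝ) ^ (s.count P * ε)) :=
        Finset.prod_le_prod (fun _ _ => by positivity) hterm
    _ = (∏ P ∈ s.toFinset, if Ideal.absNorm P ≤ B then c else 1) * (Ideal.absNorm I : ℝ) ^ ε := by
        rw [Finset.prod_mul_distrib, hnorm]
    _ ≤ _ := by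
        gcongr
        rw [← Finset.prod_filter, Finset.prod_const]
        refine pow_le_pow_right₀ hc1 (le_trans ?_ hcardP)
        rw [← Set.ncard_coe_finset]
        refine Set.ncard_le_ncard (fun P hP => ?_) hfinP
        rw [Finset.mem_coe, Finset.mem_filter] at hP
        exact ⟨hprime P hP.1, hP.2⟩

theorem exists_ncard_integral_norm_le (d : ℕ) (B : ℝ) : ∃ N : ℕ,
    ∀ (K : Type*) [Field K] [NumberField K], Module.finrank ℚ K = d →
      {x : K | IsIntegral ℤ x ∧ ∀ φ : K →+* ℂ, ‖φ x‖ ≤ B}.ncard ≤ N := by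
  classical
  set C : ℕ := Nat.ceil (max B 1 ^ d * d.choose (d / 2)) with hC
  set U : Set (Polynomial ℤ) :=
    {f | f.natDegree ≤ d ∧ ∀ i, f.coeff i ∈ Set.Icc (-C : ℤ) C} with hU
  have hUfin : U.Finite := by
    let π : Polynomial ℤ → Fin (d + 1) → ℤ := fun f i => f.coeff i
    refine ((Set.Finite.pi fun _ => Set.finite_Icc (-C : ℤ) C).subset ?_).of_finite_image
      (?_ : Set.InjOn π _)
    · exact Set.image_subset_iff.2 fun f hf i _ => hf.2 i
    · refine fun x hx y hy hxy => (Polynomial.ext_iff_natDegree_le hx.1 hy.1).2 fun i hi => ?_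
      exact congr_fun hxy ⟨i, Nat.lt_succ_of_le hi⟩
  refine ⟨hUfin.toFinset.card * d, ?_⟩
  rintro K _ _ rfl
  have hsub : {x : K | IsIntegral ℤ x ∧ ∀ φ : K →+* ℂ, ‖φ x‖ ≤ B} ⊆
      ⋃ f ∈ hUfin.toFinset, ((f.map (algebraMap ℤ K)).roots.toFinset : Set K) := by
    intro x hx
    have hmin := minpoly.isIntegrallyClosed_eq_field_fractions' ℚ hx.1
    simp only [Set.mem_iUnion, Set.Finite.mem_toFinset, exists_prop]
    refine ⟨minpoly ℤ x, ⟨?_, fun i => ?_⟩,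
      Polynomial.mem_rootSet.2 ⟨minpoly.ne_zero hx.1, minpoly.aeval ℤ x⟩⟩
    · rw [← (minpoly.monic hx.1).natDegree_map (algebraMap ℤ ℚ), ← hmin]
      exact minpoly.natDegree_le x
    rw [Set.mem_Icc, ← abs_le, ← @Int.cast_le ℝ]
    refine (Eq.trans_le ?_ <| Embeddings.coeff_bdd_of_norm_le hx.2 i).trans (Nat.le_ceil _)
    rw [hmin, Polynomial.coeff_map, eq_intCast, Int.norm_cast_rat, Int.norm_eq_abs, Int.cast_abs]
  refine (Set.ncard_le_ncard hsub ?_).trans ?_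
  · exact Set.Finite.biUnion (Finset.finite_toSet _) fun f _ => Finset.finite_toSet _
  refine (Finset.set_ncard_biUnion_le _ _).trans ?_
  rw [← smul_eq_mul]
  refine Finset.sum_le_card_nsmul _ _ _ fun f hf => ?_
  rw [Set.ncard_coe_finset]
  calc _ ≤ (f.map (algebraMap ℤ K)).roots.card := Multiset.toFinset_card_le _
    _ ≤ (f.map (algebraMap ℤ K)).natDegree := Polynomial.card_roots' _
    _ ≤ f.natDegree := Polynomial.natDegree_map_le
    _ ≤ _ := ((Set.Finite.mem_toFinset _).mp hf).1

theorem one_add_log_pow_le_mul_rpow (d : ℕ) {ε : ℝ} (hε : 0 < ε) {X : ℝ} (hX : 1 ≤ X) :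
    (1 + Real.log X) ^ d ≤ (1 + (d + 1) / ε) ^ d * X ^ ε := by
  have hη : 0 < ε / (d + 1) := by positivity
  have h1 : 1 + Real.log X ≤ (1 + (d + 1) / ε) * X ^ (ε / (d + 1)) := by
    have h2 := Real.log_le_rpow_div (zero_le_one.trans hX) hη
    have h3 : 1 ≤ X ^ (ε / (d + 1)) := Real.one_le_rpow hX hη.le
    rw [div_div_eq_mul_div] at h2
    calc 1 + Real.log X ≤ X ^ (ε / (d + 1)) + X ^ (ε / (d + 1)) * (d + 1) / ε := by linarith
      _ = _ := by ring
  have h0 : 0 ≤ 1 + Real.log X := by linarith [Real.log_nonneg hX]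
  calc (1 + Real.log X) ^ d ≤ ((1 + (d + 1) / ε) * X ^ (ε / (d + 1))) ^ d := by gcongr
    _ = (1 + (d + 1) / ε) ^ d * X ^ (ε / (d + 1) * d) := by
        rw [mul_pow, Real.rpow_mul (by positivity), Real.rpow_natCast]
    _ ≤ _ := by
        gcongr
        rw [div_mul_eq_mul_div, div_le_iff₀ (by positivity)]
        nlinarith

/-- A set of associated algebraic integers lying in a box whose volume is at most `X` times
their norm has `O(X ^ ε)` elements, uniformly in number fields of given degree. -/
theorem exists_ncard_associated_le (d : ℕ) {ε : ℝ} (hε : 0 < ε) : ∃ C : ℝ, 0 < C ∧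
    ∀ (K : Type*) [Field K] [NumberField K], Module.finrank ℚ K = d →
      ∀ (f : InfinitePlace K → ℝ) (X : ℝ) (S : Set (𝓞 K)), 1 ≤ X →
        (∀ x ∈ S, x ≠ 0) → (∀ x ∈ S, ∀ w : InfinitePlace K, w (x : K) ≤ f w) →
        (∀ x ∈ S, ∏ w, f w ^ w.mult ≤ X * ∏ w : InfinitePlace K, w (x : K) ^ w.mult) →
        (∀ x ∈ S, ∀ y ∈ S, Associated x y) →
        S.Finite ∧ (S.ncard : ℝ) ≤ C * X ^ ε := by
  classical
  obtain ⟨N, hN⟩ := exists_ncard_integral_norm_le d (Real.exp 1)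
  refine ⟨(N + 1) * (1 + (d + 1) / ε) ^ d, by positivity, ?_⟩
  rintro K _ _ rfl f X S hX hS0 hSf hSX hSa
  have hpos : ∀ x ∈ S, ∀ w : InfinitePlace K, 0 < w (x : K) := fun x hx w => by
    rw [InfinitePlace.pos_iff]
    exact_mod_cast hS0 x hx
  let k : 𝓞 K → InfinitePlace K → ℕ := fun x w => ⌊Real.log (f w / w (x : K))⌋₊
  have hlog0 : ∀ x ∈ S, ∀ w : InfinitePlace K, 0 ≤ Real.log (f w / w (x : K)) := fun x hx w =>
    Real.log_nonneg ((one_le_div (hpos x hx w)).mpr (hSf x hx w))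
  have hlogX : ∀ x ∈ S, ∀ w : InfinitePlace K, Real.log (f w / w (x : K)) ≤ Real.log X := by
    intro x hx w
    have hf : ∀ v, 0 < f v := fun v => (hpos x hx v).trans_le (hSf x hx v)
    calc Real.log (f w / w (x : K)) ≤ w.mult * Real.log (f w / w (x : K)) :=
          le_mul_of_one_le_left (hlog0 x hx w) (by exact_mod_cast w.mult_pos)
      _ ≤ ∑ v : InfinitePlace K, v.mult * Real.log (f v / v (x : K)) :=
          Finset.single_le_sum (f := fun v : InfinitePlace K => v.mult * Real.log (f v / v (x : K)))
            (fun v _ => mul_nonneg (Nat.cast_nonneg _) (hlog0 x hx v)) (Finset.mem_univ w)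
      _ = Real.log ((∏ v, f v ^ v.mult) / ∏ v : InfinitePlace K, v (x : K) ^ v.mult) := by
          rw [← Finset.prod_div_distrib, Real.log_prod]
          · refine Finset.sum_congr rfl fun v _ => ?_
            rw [← div_pow, Real.log_pow]
          · intro v _
            have := hf v
            have := hpos x hx v
            positivity
      _ ≤ Real.log X := by
          have h1 : 0 < ∏ v, f v ^ v.mult := Finset.prod_pos fun v _ => pow_pos (hf v) _
          have h2 : 0 < ∏ v : InfinitePlace K, v (x : K) ^ v.mult :=
            Finset.prod_pos fun v _ => pow_pos (hpos x hx v) _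
          refine Real.log_le_log (by positivity) ?_
          rw [div_le_iff₀ h2]
          exact hSX x hx
  set T : Finset (InfinitePlace K → ℕ) :=
    Fintype.piFinset fun _ => Finset.range (⌊Real.log X⌋₊ + 1) with hT
  have hmaps : ∀ x ∈ S, k x ∈ T := by
    intro x hx
    simp only [hT, Fintype.mem_piFinset, Finset.mem_range, Nat.lt_succ_iff]
    exact fun w => Nat.floor_le_floor (hlogX x hx w)
  have hfib : ∀ t, {x | x ∈ S ∧ k x = t}.Finite ∧ {x | x ∈ S ∧ k x = t}.ncard ≤ N := by
    intro t
    rcases Set.eq_empty_or_nonempty {x | x ∈ S ∧ k x = t} with h | ⟨y, hy, hyt⟩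
    · rw [h]; simp
    have hy0 : (y : K) ≠ 0 := by exact_mod_cast hS0 y hy
    have hm : Set.MapsTo (fun x : 𝓞 K => (x : K) / y) {x | x ∈ S ∧ k x = t}
        {x : K | IsIntegral ℤ x ∧ ∀ φ : K →+* ℂ, ‖φ x‖ ≤ Real.exp 1} := by
      rintro x ⟨hx, hxt⟩
      obtain ⟨u, hu⟩ := hSa y hy x hx
      have hxu : (x : K) / y = ((u : 𝓞 K) : K) := by
        rw [← hu]
        push_cast
        field_simp
      refine ⟨?_, fun φ => ?_⟩
      · simp only [hxu]
        exact RingOfIntegers.isIntegral_coe _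
      · rw [← InfinitePlace.apply φ]
        set w := InfinitePlace.mk φ
        simp only [map_div₀]
        have hkw : k x w = k y w := by rw [hxt, hyt]
        have h1 := Nat.lt_floor_add_one (Real.log (f w / w (y : K)))
        have h2 := Nat.floor_le (hlog0 x hx w)
        simp only [k] at hkw
        rw [← hkw] at h1
        have hfw : 0 < f w := (hpos x hx w).trans_le (hSf x hx w)
        have hwx := hpos x hx w
        have hwy := hpos y hy w
        rw [← Real.log_le_iff_le_exp (by positivity)]
        rw [Real.log_div hfw.ne' hwy.ne'] at h1
        rw [Real.log_div hfw.ne' hwx.ne'] at h2 h1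
        rw [Real.log_div hwx.ne' hwy.ne']
        linarith
    have hi : Set.InjOn (fun x : 𝓞 K => (x : K) / y) {x | x ∈ S ∧ k x = t} := by
      intro x _ x' _ h
      simpa [div_left_inj' hy0] using h
    have hfin := Embeddings.finite_of_norm_le K ℂ (Real.exp 1)
    exact ⟨Set.Finite.of_finite_image (hfin.subset hm.image_subset) hi,
      (Set.ncard_le_ncard_of_injOn _ hm hi hfin).trans (hN K rfl)⟩
  have hcov : S ⊆ ⋃ t ∈ T, {x | x ∈ S ∧ k x = t} := fun x hx => by
    simp only [Set.mem_iUnion]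
    exact ⟨k x, hmaps x hx, hx, rfl⟩
  have hcovfin : (⋃ t ∈ T, {x | x ∈ S ∧ k x = t}).Finite :=
    Set.Finite.biUnion (Finset.finite_toSet _) fun t _ => (hfib t).1
  refine ⟨hcovfin.subset hcov, ?_⟩
  have hcardS : S.ncard ≤ T.card * N :=
    ((Set.ncard_le_ncard hcov hcovfin).trans (Finset.set_ncard_biUnion_le _ _)).trans
      (by rw [← smul_eq_mul]; exact Finset.sum_le_card_nsmul _ _ _ fun t _ => (hfib t).2)
  have hcardT : (T.card : ℝ) ≤ (1 + Real.log X) ^ Module.finrank ℚ K := by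
    have hplaces : Fintype.card (InfinitePlace K) ≤ Module.finrank ℚ K := by
      rw [← Embeddings.card K ℂ]
      exact Fintype.card_le_of_surjective InfinitePlace.mk fun w => ⟨w.embedding, w.mk_embedding⟩
    have hl := Real.log_nonneg hX
    have hT' : T.card = (⌊Real.log X⌋₊ + 1) ^ Fintype.card (InfinitePlace K) := by simp [hT]
    rw [hT']
    push_cast
    calc ((⌊Real.log X⌋₊ : ℝ) + 1) ^ Fintype.card (InfinitePlace K)
        ≤ (1 + Real.log X) ^ Fintype.card (InfinitePlace K) :=
          pow_le_pow_left₀ (by positivity) (by linarith [Nat.floor_le hl]) _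
      _ ≤ _ := pow_le_pow_right₀ (by linarith) hplaces
  calc (S.ncard : ℝ) ≤ T.card * N := by exact_mod_cast hcardS
    _ ≤ ((1 + (Module.finrank ℚ K + 1) / ε) ^ Module.finrank ℚ K * X ^ ε) * (N + 1) := by
        gcongr
        · exact hcardT.trans (one_add_log_pow_le_mul_rpow _ hε hX)
        · linarith
    _ = _ := by ring

open MeasureTheory ENNReal in
/-- The measure of a set as the integral, over a fundamental domain, of its number of translates
by lattice points. -/
theorem measure_eq_lintegral_encard {E : Type*} [AddCommGroup E] [MeasurableSpace E]
    [MeasurableAdd E] {μ : Measure E} [μ.IsAddLeftInvariant] {Λ : AddSubgroup E} [Countable Λ]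
    {D S : Set E} (hD : IsAddFundamentalDomain Λ D μ) (hS : MeasurableSet S) :
    μ S = ∫⁻ x in D, (({g : Λ | (g : E) + x ∈ S}.encard : ℕ∞) : ℝ≥0∞) ∂μ := by
  rw [← lintegral_indicator_one hS, hD.lintegral_eq_tsum'', ← lintegral_tsum]
  · refine lintegral_congr fun x => ?_
    rw [← ENNReal.tsum_set_one, tsum_subtype {g : Λ | (g : E) + x ∈ S} fun _ => (1 : ℝ≥0∞)]
    exact tsum_congr fun g => rfl
  · intro g
    refine Measurable.aemeasurable ?_
    exact (measurable_one.indicator hS).comp (measurable_const_add (g : E))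

namespace NumberField

section

open mixedEmbedding MeasureTheory ENNReal NNReal InfinitePlace Module

open scoped Classical IntermediateField nonZeroDivisors

variable {K : Type*} [Field K]

theorem mem_convexBodyLT_iff {f : InfinitePlace K → ℝ≥0} {x : mixedSpace K} :
    x ∈ convexBodyLT K f ↔ ∀ w, normAtPlace w x < f w := by
  simp only [convexBodyLT, Set.mem_prod, Set.mem_pi, Set.mem_univ, true_implies,
    mem_ball_zero_iff]
  constructor
  · rintro ⟨h₁, h₂⟩ w
    rcases w.isReal_or_isComplex with hw | hw
    · rw [normAtPlace_apply_of_isReal hw]; exact h₁ ⟨w, hw⟩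
    · rw [normAtPlace_apply_of_isComplex hw]; exact h₂ ⟨w, hw⟩
  · refine fun h => ⟨fun w => ?_, fun w => ?_⟩
    · rw [← normAtPlace_apply_of_isReal w.2]; exact h w
    · rw [← normAtPlace_apply_of_isComplex w.2]; exact h w

variable [NumberField K]

/-- The lattice points of an ideal inside a box. -/
def idealBox (I : Ideal (𝓞 K)) (f : InfinitePlace K → ℝ≥0) : Set (𝓞 K) :=
  {x | x ∈ I ∧ ∀ w, w (x : K) < f w}

theorem measurableSet_convexBodyLT (f : InfinitePlace K → ℝ≥0) :
    MeasurableSet (convexBodyLT K f) :=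
  (MeasurableSet.univ_pi fun _ => measurableSet_ball).prod
    (MeasurableSet.univ_pi fun _ => measurableSet_ball)

theorem finite_idealBox (I : Ideal (𝓞 K)) (f : InfinitePlace K → ℝ≥0) :
    (idealBox I f).Finite := by
  refine Set.Finite.of_finite_image (f := fun x : 𝓞 K => (x : K)) ?_
    RingOfIntegers.coe_injective.injOn
  refine (Embeddings.finite_of_norm_le K ℂ ((Finset.univ.sup f : ℝ≥0) : ℝ)).subset ?_
  rintro _ ⟨x, hx, rfl⟩
  refine ⟨x.isIntegral_coe, fun φ => ?_⟩
  have h := hx.2 (InfinitePlace.mk φ)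
  rw [InfinitePlace.apply] at h
  exact h.le.trans (by exact_mod_cast Finset.le_sup (f := f) (Finset.mem_univ _))

/-- The ideal lattice of an integral ideal. -/
noncomputable abbrev latticeOf (I : Ideal (𝓞 K)) (hI : I ≠ ⊥) : AddSubgroup (mixedSpace K) :=
  (idealLattice K (FractionalIdeal.mk0 K ⟨I, mem_nonZeroDivisors_of_ne_zero hI⟩)).toAddSubgroup

theorem mem_latticeOf {I : Ideal (𝓞 K)} (hI : I ≠ ⊥) {y : mixedSpace K} :
    y ∈ latticeOf I hI ↔ ∃ x ∈ I, mixedEmbedding K (x : K) = y := by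
  rw [Submodule.mem_toAddSubgroup, mem_idealLattice]
  simp

theorem encard_preimage_convexBodyLT {I : Ideal (𝓞 K)} (hI : I ≠ ⊥) (f : InfinitePlace K → ℝ≥0) :
    {g : latticeOf I hI | (g : mixedSpace K) ∈ convexBodyLT K f}.encard =
      (idealBox I f).encard := by
  have h : Subtype.val '' {g : latticeOf I hI | (g : mixedSpace K) ∈ convexBodyLT K f} =
      (fun x : 𝓞 K => mixedEmbedding K (x : K)) '' idealBox I f := by
    ext y
    constructor
    · rintro ⟨⟨g, hg⟩, hgf, rfl⟩
      obtain ⟨x, hx, rfl⟩ := (mem_latticeOf hI).1 hg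
      exact ⟨x, ⟨hx, (convexBodyLT_mem K f).1 hgf⟩, rfl⟩
    · rintro ⟨x, hx, rfl⟩
      exact ⟨⟨_, (mem_latticeOf hI).2 ⟨x, hx.1, rfl⟩⟩, (convexBodyLT_mem K f).2 hx.2, rfl⟩
  rw [← Subtype.val_injective.injOn.encard_image, h, Set.InjOn.encard_image]
  exact ((mixedEmbedding_injective K).comp RingOfIntegers.coe_injective).injOn

theorem exists_isAddFundamentalDomain_latticeOf {I : Ideal (𝓞 K)} (hI : I ≠ ⊥) :
    ∃ D : Set (mixedSpace K), IsAddFundamentalDomain (latticeOf I hI) D volume ∧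
      volume D = ENNReal.ofReal
        (Ideal.absNorm I * ((2 : ℝ)⁻¹ ^ nrComplexPlaces K * √|(discr K : ℝ)|)) := by
  refine ⟨_, fundamentalDomain_idealLattice K _, ?_⟩
  rw [volume_fundamentalDomain_fractionalIdealLatticeBasis,
    volume_fundamentalDomain_latticeBasis, ENNReal.ofReal_mul (by positivity)]
  congr 1
  · rw [FractionalIdeal.coe_mk0, FractionalIdeal.coeIdeal_absNorm]
    simp
  · rw [ENNReal.ofReal_mul (by positivity), ENNReal.ofReal_pow (by positivity),
      ENNReal.ofReal_inv_of_pos (by positivity)]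
    congr 1
    · simp
    · rw [← ENNReal.ofReal_coe_nnreal]
      simp [Int.norm_eq_abs]

theorem convexBodyLT_volume_eq_ofReal (f : InfinitePlace K → ℝ≥0) :
    volume (convexBodyLT K f) =
      ENNReal.ofReal (convexBodyLTFactor K * ∏ w, (f w : ℝ) ^ w.mult) := by
  rw [convexBodyLT_volume, ← ENNReal.coe_mul, ← ENNReal.ofReal_coe_nnreal]
  push_cast
  rfl

instance {I : Ideal (𝓞 K)} (hI : I ≠ ⊥) : Countable (latticeOf I hI) := by
  change Countable (idealLattice K _)
  rw [← span_idealLatticeBasis]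
  infer_instance

/-- Minkowski-type lower bound for the number of elements of an ideal in a box. -/
theorem prod_le_mul_ncard_idealBox {I : Ideal (𝓞 K)} (hI : I ≠ ⊥) (f : InfinitePlace K → ℝ≥0) :
    ∏ w, (f w : ℝ) ^ w.mult ≤
      2 ^ finrank ℚ K * (Ideal.absNorm I * √|(discr K : ℝ)|) * (idealBox I f).ncard := by
  obtain ⟨D, hD, hvol⟩ := exists_isAddFundamentalDomain_latticeOf hI
  have hcount : ∀ x : mixedSpace K,
      {g : latticeOf I hI | (g : mixedSpace K) + x ∈ convexBodyLT K (fun w => f w / 2)}.encard ≤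
        (idealBox I f).encard := by
    intro x
    rcases Set.eq_empty_or_nonempty
      {g : latticeOf I hI | (g : mixedSpace K) + x ∈ convexBodyLT K (fun w => f w / 2)} with
      h | ⟨g₀, hg₀⟩
    · rw [h]; simp
    rw [← encard_preimage_convexBodyLT hI, ← (sub_left_injective (b := g₀)).injOn.encard_image]
    refine Set.encard_le_encard ?_
    rintro _ ⟨g, hg, rfl⟩
    simp only [Set.mem_ofPred_eq, mem_convexBodyLT_iff] at hg hg₀ ⊢
    intro w
    have h := normAtPlace_add_le w ((g : mixedSpace K) + x) (-((g₀ : mixedSpace K) + x))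
    rw [normAtPlace_neg] at h
    have h1 := hg w
    have h2 := hg₀ w
    push_cast at h1 h2
    calc normAtPlace w ((g - g₀ : latticeOf I hI) : mixedSpace K)
        = normAtPlace w ((g : mixedSpace K) + x + -((g₀ : mixedSpace K) + x)) := by
          push_cast; congr 1; abel
      _ < f w := by linarith
  have hle : volume (convexBodyLT K (fun w => f w / 2)) ≤
      ((idealBox I f).ncard : ℝ≥0∞) * volume D := by
    rw [measure_eq_lintegral_encard hD (measurableSet_convexBodyLT _), ← setLIntegral_const]
    refine lintegral_mono fun x => ?_
    have := hcount x
    rw [← (finite_idealBox I f).cast_ncard_eq] at this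
    calc _ ≤ (((idealBox I f).ncard : ℕ∞) : ℝ≥0∞) := by exact_mod_cast this
      _ = _ := by simp
  rw [convexBodyLT_volume_eq_ofReal, hvol, ← ENNReal.ofReal_natCast,
    ← ENNReal.ofReal_mul (by positivity), ENNReal.ofReal_le_ofReal_iff (by positivity)] at hle
  have hle' : ∏ w, ((f w : ℝ) / 2) ^ w.mult ≤
      (idealBox I f).ncard * (Ideal.absNorm I * ((2 : ℝ)⁻¹ ^ nrComplexPlaces K *
        √|(discr K : ℝ)|)) := by
    refine le_trans ?_ hle
    refine le_trans (by push_cast; rfl) (le_mul_of_one_le_left (by positivity)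
      (NNReal.one_le_coe.2 (one_le_convexBodyLTFactor K)))
  have hprod : ∏ w, ((f w : ℝ) / 2) ^ w.mult = (∏ w, (f w : ℝ) ^ w.mult) / 2 ^ finrank ℚ K := by
    simp_rw [div_pow]
    rw [Finset.prod_div_distrib, Finset.prod_pow_eq_pow_sum, sum_mult_eq]
  rw [hprod, div_le_iff₀ (by positivity)] at hle'
  refine hle'.trans ?_
  have h2 : ((2 : ℝ)⁻¹) ^ nrComplexPlaces K ≤ 1 := pow_le_one₀ (by norm_num) (by norm_num)
  calc _ ≤ (idealBox I f).ncard * (Ideal.absNorm I * (1 * √|(discr K : ℝ)|)) *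
        2 ^ finrank ℚ K := by gcongr
    _ = _ := by ring

/-- Upper bound for the number of elements of an ideal in a box whose translates by the ideal cover
the whole space. -/
theorem ncard_idealBox_mul_le {I : Ideal (𝓞 K)} (hI : I ≠ ⊥) (f : InfinitePlace K → ℝ≥0)
    (hcover : ∀ x : mixedSpace K, ∃ g ∈ I, x - mixedEmbedding K (g : K) ∈ convexBodyLT K f) :
    (idealBox I f).ncard * (Ideal.absNorm I * √|(discr K : ℝ)|) ≤
      16 ^ finrank ℚ K * ∏ w, (f w : ℝ) ^ w.mult := by
  obtain ⟨D, hD, hvol⟩ := exists_isAddFundamentalDomain_latticeOf hI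
  have hcount : ∀ x : mixedSpace K, (idealBox I f).encard ≤
      {g : latticeOf I hI | (g : mixedSpace K) + x ∈ convexBodyLT K (fun w => 2 * f w)}.encard := by
    intro x
    obtain ⟨g, hg, hx⟩ := hcover x
    set g₀ : latticeOf I hI := ⟨_, (mem_latticeOf hI).2 ⟨g, hg, rfl⟩⟩
    rw [← encard_preimage_convexBodyLT hI, ← (sub_left_injective (b := g₀)).injOn.encard_image]
    refine Set.encard_le_encard ?_
    rintro _ ⟨a, ha, rfl⟩
    simp only [Set.mem_ofPred_eq, mem_convexBodyLT_iff] at ha hx ⊢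
    intro w
    have h := normAtPlace_add_le w (a : mixedSpace K) (x - mixedEmbedding K (g : K))
    have h1 := ha w
    have h2 := hx w
    calc normAtPlace w (((a - g₀ : latticeOf I hI) : mixedSpace K) + x)
        = normAtPlace w ((a : mixedSpace K) + (x - mixedEmbedding K (g : K))) := by
          push_cast; congr 1; simp only [g₀]; abel
      _ < _ := by push_cast; linarith
  have hle : ((idealBox I f).ncard : ℝ≥0∞) * volume D ≤
      volume (convexBodyLT K (fun w => 2 * f w)) := by
    rw [measure_eq_lintegral_encard hD (measurableSet_convexBodyLT _), ← setLIntegral_const]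
    refine lintegral_mono fun x => ?_
    have := hcount x
    rw [← (finite_idealBox I f).cast_ncard_eq] at this
    calc _ = (((idealBox I f).ncard : ℕ∞) : ℝ≥0∞) := by simp
      _ ≤ _ := by exact_mod_cast this
  rw [convexBodyLT_volume_eq_ofReal, hvol, ← ENNReal.ofReal_natCast,
    ← ENNReal.ofReal_mul (by positivity), ENNReal.ofReal_le_ofReal_iff (by positivity)] at hle
  push_cast at hle
  rw [NNReal.coe_real_pi] at hle
  have hprod : ∏ w, (2 * (f w : ℝ)) ^ w.mult = 2 ^ finrank ℚ K * ∏ w, (f w : ℝ) ^ w.mult := by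
    simp_rw [mul_pow]
    rw [Finset.prod_mul_distrib, Finset.prod_pow_eq_pow_sum, sum_mult_eq]
  have hdeg := card_add_two_mul_card_eq_rank K
  rw [hprod] at hle
  have hfac : (2 : ℝ) ^ nrRealPlaces K * Real.pi ^ nrComplexPlaces K * 2 ^ nrComplexPlaces K ≤
      8 ^ finrank ℚ K := by
    rw [← hdeg]
    calc _ ≤ (8 : ℝ) ^ nrRealPlaces K * 4 ^ nrComplexPlaces K * 2 ^ nrComplexPlaces K := by
          gcongr
          · norm_num
          · exact Real.pi_le_four
      _ = (8 : ℝ) ^ (nrRealPlaces K + nrComplexPlaces K) := by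
          rw [mul_assoc, ← mul_pow, pow_add]; norm_num
      _ ≤ _ := pow_le_pow_right₀ (by norm_num) (by omega)
  calc _ = ((idealBox I f).ncard * (Ideal.absNorm I * ((2 : ℝ)⁻¹ ^ nrComplexPlaces K *
        √|(discr K : ℝ)|))) * 2 ^ nrComplexPlaces K := by
        rw [inv_pow]; field_simp
    _ ≤ ((2 : ℝ) ^ nrRealPlaces K * Real.pi ^ nrComplexPlaces K *
        (2 ^ finrank ℚ K * ∏ w, (f w : ℝ) ^ w.mult)) * 2 ^ nrComplexPlaces K := by
        exact mul_le_mul_of_nonneg_right hle (by positivity)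
    _ = ((2 : ℝ) ^ nrRealPlaces K * Real.pi ^ nrComplexPlaces K * 2 ^ nrComplexPlaces K) *
        (2 ^ finrank ℚ K * ∏ w, (f w : ℝ) ^ w.mult) := by ring
    _ ≤ 8 ^ finrank ℚ K * (2 ^ finrank ℚ K * ∏ w, (f w : ℝ) ^ w.mult) := by gcongr
    _ = _ := by rw [← mul_assoc, ← mul_pow]; norm_num

theorem one_le_abs_discr : (1 : ℝ) ≤ |(discr K : ℝ)| := by
  exact_mod_cast Int.one_le_abs (discr_ne_zero K)

theorem exists_primitive_element_le : ∃ α : 𝓞 K, ℚ⟮(α : K)⟯ = ⊤ ∧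
    ∀ w : InfinitePlace K, w α ≤ 2 ^ (finrank ℚ K + 2) * √|(discr K : ℝ)| := by
  set B : ℝ≥0 := 2 ^ (finrank ℚ K) * NNReal.sqrt ‖discr K‖₊ + 1 with hB
  have hs : √‖discr K‖ = √|(discr K : ℝ)| := by
    simp [Int.norm_eq_abs]
  have hlt : ∀ c : ℝ≥0, 1 ≤ c → minkowskiBound K ↑1 < c * B := by
    intro c hc
    rw [minkowskiBound, volume_fundamentalDomain_fractionalIdealLatticeBasis,
      volume_fundamentalDomain_latticeBasis]
    rw [show finrank ℝ (mixedSpace K) = finrank ℚ K from mixedEmbedding.finrank K]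
    have h2 : (2⁻¹ : ℝ≥0) ^ nrComplexPlaces K ≤ 1 := pow_le_one₀ (by positivity) (by
      rw [← NNReal.coe_le_coe]; norm_num)
    calc _ = (((2⁻¹ : ℝ≥0) ^ nrComplexPlaces K * NNReal.sqrt ‖discr K‖₊ * 2 ^ finrank ℚ K : ℝ≥0) :
          ℝ≥0∞) := by
          push_cast
          simp
      _ < ((c * B : ℝ≥0) : ℝ≥0∞) := by
          rw [ENNReal.coe_lt_coe]
          calc _ ≤ 1 * NNReal.sqrt ‖discr K‖₊ * 2 ^ finrank ℚ K := by gcongr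
            _ < 2 ^ finrank ℚ K * NNReal.sqrt ‖discr K‖₊ + 1 := by
              rw [one_mul, mul_comm]; exact lt_add_one _
            _ ≤ c * B := le_mul_of_one_le_left' hc
      _ = _ := by push_cast; rfl
  have h1 : (1 : ℝ) ≤ √|(discr K : ℝ)| := Real.one_le_sqrt.2 one_le_abs_discr
  have h2 : (1 : ℝ) ≤ 2 ^ finrank ℚ K := one_le_pow₀ (by norm_num)
  have hBle : (B : ℝ) + 1 ≤ 2 ^ (finrank ℚ K + 2) * √|(discr K : ℝ)| := by
    rw [hB]
    push_cast
    rw [hs, pow_add]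
    nlinarith [mul_le_mul h2 h1 (by norm_num) (by positivity)]
  obtain ⟨w₀⟩ := (inferInstance : Nonempty (InfinitePlace K))
  rcases w₀.isReal_or_isComplex with hw | hw
  · obtain ⟨a, ha, h⟩ := exists_primitive_element_lt_of_isReal K hw
      (hlt _ (one_le_convexBodyLTFactor K))
    refine ⟨a, ha, fun w => (h w).le.trans (le_trans ?_ hBle)⟩
    push_cast
    exact max_le (by linarith) (by linarith [B.2])
  · obtain ⟨a, ha, h⟩ := exists_primitive_element_lt_of_isComplex K hw
      (hlt _ (one_le_convexBodyLT'Factor K))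
    refine ⟨a, ha, fun w => (h w).le.trans (le_trans ?_ hBle)⟩
    refine Real.sqrt_le_iff.2 ⟨by positivity, ?_⟩
    nlinarith [B.2]

theorem span_range_mixedEmbedding_pow {α : 𝓞 K} (hα : ℚ⟮(α : K)⟯ = ⊤) :
    Submodule.span ℝ (Set.range fun i : Fin (finrank ℚ K) => mixedEmbedding K ((α : K) ^ (i : ℕ)))
      = ⊤ := by
  have hint : IsIntegral ℚ (α : K) := Algebra.IsIntegral.isIntegral _
  let pb := PowerBasis.ofAdjoinEqTop hint
    (Algebra.adjoin_eq_top_of_primitive_element hint.isAlgebraic hα)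
  have hdim : pb.dim = finrank ℚ K := pb.finrank.symm
  have key : ∀ z : K, mixedEmbedding K z ∈ Submodule.span ℝ
      (Set.range fun i : Fin (finrank ℚ K) => mixedEmbedding K ((α : K) ^ (i : ℕ))) := by
    intro z
    rw [← pb.basis.sum_repr z, map_sum]
    refine Submodule.sum_mem _ fun i _ => ?_
    rw [map_rat_smul, ← Rat.cast_smul_eq_qsmul ℝ]
    refine Submodule.smul_mem _ _ (Submodule.subset_span ⟨Fin.cast hdim i, ?_⟩)
    have : pb.basis i = (α : K) ^ (i : ℕ) := by
      rw [pb.coe_basis, PowerBasis.ofAdjoinEqTop_gen]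
    simp [this]
  rw [eq_top_iff, ← (latticeBasis K).span_eq, Submodule.span_le]
  rintro _ ⟨i, rfl⟩
  rw [latticeBasis_apply]
  exact key _

theorem exists_sub_mem_convexBodyLT {I : Ideal (𝓞 K)} {α : 𝓞 K} (hα : ℚ⟮(α : K)⟯ = ⊤) {A : ℝ}
    (hA : 1 ≤ A) (hαA : ∀ w : InfinitePlace K, w (α : K) ≤ A) {f : InfinitePlace K → ℝ≥0}
    (hf : ∀ w, finrank ℚ K * (Ideal.absNorm I * A ^ finrank ℚ K) < f w) (hI : I ≠ ⊥)
    (x : mixedSpace K) :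
    ∃ g ∈ I, x - mixedEmbedding K (g : K) ∈ convexBodyLT K f := by
  have hN : (Ideal.absNorm I : ℝ) ≠ 0 := by
    simpa [Ideal.absNorm_eq_zero_iff] using hI
  have hx : (Ideal.absNorm I : ℝ)⁻¹ • x ∈ (⊤ : Submodule ℝ (mixedSpace K)) := trivial
  rw [← span_range_mixedEmbedding_pow hα, Submodule.mem_span_range_iff_exists_fun] at hx
  obtain ⟨c, hc⟩ := hx
  refine ⟨∑ i, ⌊c i⌋ • ((Ideal.absNorm I : 𝓞 K) * α ^ (i : ℕ)), ?_, ?_⟩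
  · exact Submodule.sum_mem _ fun i _ => zsmul_mem
      (I.mul_mem_right _ (Ideal.absNorm_mem I)) _
  · have hx' : x = ∑ i, c i • mixedEmbedding K ((Ideal.absNorm I : K) * (α : K) ^ (i : ℕ)) := by
      rw [← inv_smul_smul₀ hN x, smul_comm, ← hc, Finset.smul_sum]
      refine Finset.sum_congr rfl fun i _ => ?_
      rw [smul_comm, map_mul, map_natCast, ← nsmul_eq_mul, Nat.cast_smul_eq_nsmul]
    have hsub : x - mixedEmbedding K ((∑ i, ⌊c i⌋ • ((Ideal.absNorm I : 𝓞 K) * α ^ (i : ℕ)) :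
        𝓞 K) : K) = ∑ i, Int.fract (c i) •
          mixedEmbedding K ((Ideal.absNorm I : K) * (α : K) ^ (i : ℕ)) := by
      have hcoe : ((∑ i, ⌊c i⌋ • ((Ideal.absNorm I : 𝓞 K) * α ^ (i : ℕ)) : 𝓞 K) : K) =
          ∑ i, ⌊c i⌋ • ((Ideal.absNorm I : K) * (α : K) ^ (i : ℕ)) := by
        simp [map_sum]
      conv_lhs => rw [hx', hcoe]
      rw [map_sum, ← Finset.sum_sub_distrib]
      refine Finset.sum_congr rfl fun i _ => ?_
      rw [Int.fract, sub_smul, map_zsmul, ← Int.cast_smul_eq_zsmul ℝ]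
    rw [hsub, mem_convexBodyLT_iff]
    intro w
    refine lt_of_le_of_lt ?_ (hf w)
    have hsum : ∀ (s : Finset (Fin (finrank ℚ K))) (v : Fin (finrank ℚ K) → mixedSpace K),
        normAtPlace w (∑ i ∈ s, v i) ≤ ∑ i ∈ s, normAtPlace w (v i) := fun s v =>
      Finset.le_sum_of_subadditive _ (map_zero _).le (normAtPlace_add_le w) _ _
    refine (hsum _ _).trans ?_
    calc _ ≤ ∑ i : Fin (finrank ℚ K), (Ideal.absNorm I * A ^ finrank ℚ K : ℝ) := by
          refine Finset.sum_le_sum fun i _ => ?_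
          rw [normAtPlace_smul, abs_of_nonneg (Int.fract_nonneg _), normAtPlace_apply, map_mul,
            map_pow]
          have h1 : w (Ideal.absNorm I : K) = Ideal.absNorm I := by
            rw [← norm_embedding_eq]; simp
          rw [h1]
          calc _ ≤ 1 * ((Ideal.absNorm I : ℝ) * w (α : K) ^ (i : ℕ)) := by
                gcongr
                exact (Int.fract_lt_one _).le
            _ ≤ Ideal.absNorm I * A ^ (i : ℕ) := by
                rw [one_mul]; gcongr; exact hαA w
            _ ≤ _ := by gcongr; exact i.2.le
      _ = _ := by simp

theorem ncard_idealBox_mul_le_of_lt {I : Ideal (𝓞 K)} (hI : I ≠ ⊥) (f : InfinitePlace K → ℝ≥0)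
    (hf : ∀ w, finrank ℚ K * (Ideal.absNorm I *
      (2 ^ (finrank ℚ K + 2) * √|(discr K : ℝ)|) ^ finrank ℚ K) < f w) :
    (idealBox I f).ncard * (Ideal.absNorm I * √|(discr K : ℝ)|) ≤
      16 ^ finrank ℚ K * ∏ w, (f w : ℝ) ^ w.mult := by
  obtain ⟨α, hα, hle⟩ := exists_primitive_element_le (K := K)
  refine ncard_idealBox_mul_le hI f fun x => exists_sub_mem_convexBodyLT hα ?_ hle hf hI x
  exact one_le_mul_of_one_le_of_one_le (one_le_pow₀ (by norm_num))
    (Real.one_le_sqrt.2 one_le_abs_discr)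

theorem exists_mk0_eq_absNorm_le (c : ClassGroup (𝓞 K)) : ∃ J : (Ideal (𝓞 K))⁰,
    ClassGroup.mk0 J = c ∧
      (Ideal.absNorm (J : Ideal (𝓞 K)) : ℝ) ≤ 2 ^ finrank ℚ K * √|(discr K : ℝ)| := by
  obtain ⟨J, hJ, hle⟩ := exists_ideal_in_class_of_norm_le c
  refine ⟨J, hJ, hle.trans ?_⟩
  have h1 : (4 / Real.pi) ^ nrComplexPlaces K ≤ (2 : ℝ) ^ finrank ℚ K := by
    calc (4 / Real.pi) ^ nrComplexPlaces K ≤ (2 : ℝ) ^ nrComplexPlaces K := by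
          gcongr
          rw [div_le_iff₀ Real.pi_pos]
          linarith [Real.two_le_pi]
      _ ≤ _ := pow_le_pow_right₀ (by norm_num) (by
          rw [← card_add_two_mul_card_eq_rank K]; omega)
  have h2 : ((finrank ℚ K).factorial : ℝ) / (finrank ℚ K : ℝ) ^ finrank ℚ K ≤ 1 := by
    refine div_le_one_of_le₀ ?_ (by positivity)
    exact_mod_cast Nat.factorial_le_pow _
  calc _ ≤ (2 : ℝ) ^ finrank ℚ K * (1 * √|(discr K : ℝ)|) := by
        gcongr
    _ = _ := by rw [one_mul]

end

end NumberField

theorem Finset.card_le_card_mul_of_card_fiber_le {α β : Type*} [DecidableEq β] {s : Finset α}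
    {t : Finset β} {g : α → β} {B : ℝ} (hg : ∀ a ∈ s, g a ∈ t)
    (hB : ∀ y ∈ t, (({a ∈ s | g a = y} : Finset α).card : ℝ) ≤ B) :
    (s.card : ℝ) ≤ t.card * B := by
  rw [Finset.card_eq_sum_card_fiberwise hg, Nat.cast_sum]
  exact (Finset.sum_le_card_nsmul _ _ _ hB).trans_eq (nsmul_eq_mul _ _)

namespace NumberField

open Module InfinitePlace
open scoped NNReal nonZeroDivisors

section

variable {K : Type*} [Field K] [NumberField K]

theorem prod_pow_mult_eq_absNorm_span (x : 𝓞 K) :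
    ∏ w : InfinitePlace K, w (x : K) ^ w.mult = Ideal.absNorm (Ideal.span {x}) := by
  rw [prod_eq_abs_norm, Ideal.absNorm_span_singleton, ← Algebra.coe_norm_int, Nat.cast_natAbs]
  push_cast
  rfl

end

variable {F L : Type*} [Field F] [NumberField F] [Field L] [NumberField L] [Algebra F L]

theorem norm_embedding_norm_lt (φ : F →+* ℂ) {x : L} (hx : x ≠ 0) {t : ℝ}
    (h : ∀ τ : L →+* ℂ, τ.comp (algebraMap F L) = φ → ‖τ x‖ < t) :
    ‖φ (Algebra.norm F x)‖ < t ^ finrank F L := by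
  let := φ.toAlgebra
  have hprod := Algebra.norm_eq_prod_embeddings F ℂ x
  change φ (Algebra.norm F x) = _ at hprod
  rw [hprod, norm_prod, ← AlgHom.card F L ℂ, ← Finset.card_univ, ← Finset.prod_const]
  refine Finset.prod_lt_prod_of_nonempty (fun τ _ => ?_) (fun τ _ => ?_) ?_
  · rw [norm_pos_iff]
    exact (map_ne_zero τ).2 hx
  · exact h τ.toRingHom τ.comp_algebraMap
  · rw [← Finset.card_pos, Finset.card_univ, AlgHom.card F L ℂ]
    exact finrank_pos

/-- A box in `L`, adapted to the fractional ideal generated by `b / a`. -/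
noncomputable def twistedBox (T : ℝ) (a b : 𝓞 F) (v : InfinitePlace L) : ℝ≥0 :=
  Real.toNNReal (T * (v (algebraMap F L b) / v (algebraMap F L a)) ^ (finrank F L : ℝ)⁻¹)

theorem coe_twistedBox {F L : Type*} [Field F] [Field L] [Algebra F L] {T : ℝ}
    (hT : 0 ≤ T) (a b : 𝓞 F) (v : InfinitePlace L) :
    (twistedBox T a b v : ℝ) =
      T * (v (algebraMap F L b) / v (algebraMap F L a)) ^ (finrank F L : ℝ)⁻¹ :=
  Real.coe_toNNReal _ (by positivity)

theorem prod_pow_mult_algebraMap (a : 𝓞 F) :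
    ∏ v : InfinitePlace L, v (algebraMap F L a) ^ v.mult =
      (Ideal.absNorm (Ideal.span {a}) : ℝ) ^ finrank F L := by
  rw [prod_eq_abs_norm, ← prod_pow_mult_eq_absNorm_span, prod_eq_abs_norm,
    ← Algebra.norm_norm (S := F), Algebra.norm_algebraMap, map_pow]
  push_cast
  rw [abs_pow]

theorem prod_twistedBox {T : ℝ} (hT : 0 ≤ T) (a b : 𝓞 F) :
    ∏ v : InfinitePlace L, (twistedBox T a b v : ℝ) ^ v.mult =
      T ^ finrank ℚ L * (Ideal.absNorm (Ideal.span {b}) / Ideal.absNorm (Ideal.span {a})) := by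
  have hn : finrank F L ≠ 0 := finrank_pos.ne'
  simp_rw [coe_twistedBox hT, mul_pow]
  rw [Finset.prod_mul_distrib, Finset.prod_pow_eq_pow_sum, sum_mult_eq]
  congr 1
  have : ∀ v : InfinitePlace L, ((v (algebraMap F L b) / v (algebraMap F L a)) ^
      (finrank F L : ℝ)⁻¹) ^ v.mult =
      ((v (algebraMap F L b) / v (algebraMap F L a)) ^ v.mult) ^ (finrank F L : ℝ)⁻¹ := fun v => by
    rw [← Real.rpow_natCast, ← Real.rpow_mul (by positivity), mul_comm,
      Real.rpow_mul (by positivity), Real.rpow_natCast]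
  simp_rw [this]
  rw [Real.finsetProd_rpow _ _ fun v _ => by positivity]
  simp_rw [div_pow]
  rw [Finset.prod_div_distrib, prod_pow_mult_algebraMap, prod_pow_mult_algebraMap, ← div_pow,
    Real.pow_rpow_inv_natCast (by positivity) hn]

theorem norm_mul_lt_of_lt_twistedBox {T : ℝ} (hT : 0 ≤ T) {a b : 𝓞 F} (ha : a ≠ 0) {x : L}
    (hx : x ≠ 0) (h : ∀ v : InfinitePlace L, v x < twistedBox T a b v) (w : InfinitePlace F) :
    w (Algebra.norm F x) * w (a : F) < T ^ finrank F L * w (b : F) := by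
  have hn : finrank F L ≠ 0 := finrank_pos.ne'
  have hwa : 0 < w (a : F) := pos_iff.2 (by simpa using ha)
  have key := norm_embedding_norm_lt w.embedding hx
    (t := T * (w (b : F) / w (a : F)) ^ (finrank F L : ℝ)⁻¹) fun τ hτ => by
      have h1 := h (InfinitePlace.mk τ)
      rw [coe_twistedBox hT] at h1
      simp only [InfinitePlace.apply] at h1
      have h2 : ∀ z : F, ‖τ (algebraMap F L z)‖ = w z := fun z => by
        rw [← norm_embedding_eq, ← hτ]; rfl
      rwa [h2, h2] at h1
  rw [norm_embedding_eq, mul_pow, Real.rpow_inv_natCast_pow (by positivity) hn] at key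
  calc _ < T ^ finrank F L * (w (b : F) / w (a : F)) * w (a : F) :=
        mul_lt_mul_of_pos_right key hwa
    _ = _ := by field_simp

theorem exists_mul_eq_mul_intNorm {I : Ideal (𝓞 L)} {J : Ideal (𝓞 F)} {a b : 𝓞 F}
    (hab : Ideal.span {a} * Ideal.relNorm (𝓞 F) I = Ideal.span {b} * J) {x : 𝓞 L} (hx : x ∈ I) :
    ∃ y ∈ J, b * y = a * Algebra.intNorm (𝓞 F) (𝓞 L) x := by
  rw [← Ideal.mem_span_singleton_mul, ← hab, Ideal.mem_span_singleton_mul]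
  refine ⟨_, ?_, rfl⟩
  rw [Ideal.relNorm_apply]
  exact Ideal.subset_span ⟨x, hx, rfl⟩

theorem coe_intNorm (x : 𝓞 L) :
    ((Algebra.intNorm (𝓞 F) (𝓞 L) x : 𝓞 F) : F) = Algebra.norm F (x : L) :=
  Algebra.algebraMap_intNorm (A := 𝓞 F) (K := F) (L := L) (B := 𝓞 L) x

theorem mem_idealBox_of_mul_eq_mul_intNorm {T : ℝ} (hT : 0 ≤ T) {I : Ideal (𝓞 L)} {J : Ideal (𝓞 F)}
    {a b : 𝓞 F} (ha : a ≠ 0) (hb : b ≠ 0) {x : 𝓞 L} (hx : x ∈ idealBox I (twistedBox T a b))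
    (hx0 : x ≠ 0) {y : 𝓞 F} (hyJ : y ∈ J) (hy : b * y = a * Algebra.intNorm (𝓞 F) (𝓞 L) x) :
    y ∈ idealBox J fun _ => Real.toNNReal (T ^ finrank F L) := by
  refine ⟨hyJ, fun w => ?_⟩
  rw [Real.coe_toNNReal _ (by positivity)]
  have h := norm_mul_lt_of_lt_twistedBox hT ha (x := (x : L)) (by simpa using hx0) hx.2 w
  have hwb : 0 < w (b : F) := pos_iff.2 (by simpa using hb)
  have hy' := congrArg (fun z : 𝓞 F => w (z : F)) hy
  simp only [map_mul, coe_intNorm] at hy'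
  rw [mul_comm, ← hy', mul_comm] at h
  exact lt_of_mul_lt_mul_right h hwb.le

theorem absNorm_span_eq_mul_absNorm {I A : Ideal (𝓞 L)} {J : Ideal (𝓞 F)} {a b : 𝓞 F} (hb : b ≠ 0)
    (hab : Ideal.span {a} * Ideal.relNorm (𝓞 F) I = Ideal.span {b} * J) {x : 𝓞 L}
    (hA : I * A = Ideal.span {x}) {y : 𝓞 F}
    (hy : b * y = a * Algebra.intNorm (𝓞 F) (𝓞 L) x) :
    Ideal.absNorm (Ideal.span {y}) = Ideal.absNorm J * Ideal.absNorm A := by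
  have h : Ideal.span {b} * Ideal.span {y} = Ideal.span {b} * (J * Ideal.relNorm (𝓞 F) A) := by
    rw [← mul_assoc, ← hab, mul_assoc, ← map_mul, hA, Ideal.relNorm_singleton,
      Ideal.span_singleton_mul_span_singleton, Ideal.span_singleton_mul_span_singleton, hy]
  have h' := mul_left_cancel₀ (by simpa using hb) h
  rw [h', map_mul, Ideal.absNorm_relNorm]

theorem sum_ncard_idealBox_twistedBox_le {ε C₁ C₂ X T : ℝ} (hε : 0 < ε) (hC₁ : 0 < C₁)
    (hC₂ : 0 < C₂) (hX : 1 ≤ X) (hT : 0 < T)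
    (hdiv : ∀ I : Ideal (𝓞 L), I ≠ 0 → {A | A ∣ I}.Finite ∧
      ({A | A ∣ I}.ncard : ℝ) ≤ C₁ * (Ideal.absNorm I : ℝ) ^ ε)
    (hunit : ∀ (f : InfinitePlace L → ℝ) (X : ℝ) (S : Set (𝓞 L)), 1 ≤ X → (∀ x ∈ S, x ≠ 0) →
      (∀ x ∈ S, ∀ w : InfinitePlace L, w (x : L) ≤ f w) →
      (∀ x ∈ S, ∏ w, f w ^ w.mult ≤ X * ∏ w : InfinitePlace L, w (x : L) ^ w.mult) →
      (∀ x ∈ S, ∀ y ∈ S, Associated x y) → S.Finite ∧ (S.ncard : ℝ) ≤ C₂ * X ^ ε)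
    {J : Ideal (𝓞 F)} (hJ : J ≠ ⊥) (hTX : T ^ finrank ℚ L = X * Ideal.absNorm J)
    (s : Finset (ClassGroup (𝓞 L))) (I : ClassGroup (𝓞 L) → (Ideal (𝓞 L))⁰)
    (hI : ∀ c, ClassGroup.mk0 (I c) = c) (a b : ClassGroup (𝓞 L) → 𝓞 F)
    (ha : ∀ c ∈ s, a c ≠ 0) (hb : ∀ c ∈ s, b c ≠ 0)
    (hab : ∀ c ∈ s, Ideal.span {a c} * Ideal.relNorm (𝓞 F) (I c : Ideal (𝓞 L)) =
      Ideal.span {b c} * J) :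
    ∑ c ∈ s, ((idealBox (I c : Ideal (𝓞 L)) (twistedBox T (a c) (b c)) \ {0}).ncard : ℝ) ≤
      (idealBox J fun _ => Real.toNNReal (T ^ finrank F L)).ncard *
        ((C₁ * (X ^ finrank ℚ L) ^ ε) * (C₂ * X ^ ε)) := by
  classical
  set B : ClassGroup (𝓞 L) → Set (𝓞 L) := fun c =>
    idealBox (I c : Ideal (𝓞 L)) (twistedBox T (a c) (b c)) \ {0} with hB
  have hBfin : ∀ c, (B c).Finite := fun c => (finite_idealBox _ _).subset Set.sdiff_subset
  set P : Finset (Σ _ : ClassGroup (𝓞 L), 𝓞 L) := s.sigma fun c => (hBfin c).toFinset with hP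
  have hmem : ∀ p ∈ P, p.1 ∈ s ∧ p.2 ∈ idealBox (I p.1 : Ideal (𝓞 L))
      (twistedBox T (a p.1) (b p.1)) ∧ p.2 ≠ 0 := by
    intro p hp
    simpa [hP, hB] using hp
  have hcard : ∑ c ∈ s, ((B c).ncard : ℝ) = P.card := by
    rw [hP, Finset.card_sigma, Nat.cast_sum]
    exact Finset.sum_congr rfl fun c _ => by rw [Set.ncard_eq_toFinset_card _ (hBfin c)]
  rw [hcard]
  have hJ0 : Ideal.absNorm J ≠ 0 := by simpa [Ideal.absNorm_eq_zero_iff] using hJ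
  have hyex : ∀ p ∈ P, ∃ y ∈ J, b p.1 * y = a p.1 * Algebra.intNorm (𝓞 F) (𝓞 L) p.2 :=
    fun p hp => exists_mul_eq_mul_intNorm (hab _ (hmem p hp).1) (hmem p hp).2.1.1
  choose! y hyJ hy using hyex
  have hAex : ∀ p ∈ P, ∃ A : Ideal (𝓞 L), (I p.1 : Ideal (𝓞 L)) * A = Ideal.span {p.2} := by
    intro p hp
    obtain ⟨A, hA⟩ := Ideal.dvd_span_singleton.2 (hmem p hp).2.1.1
    exact ⟨A, hA.symm⟩
  choose! A hA using hAex
  have hA0 : ∀ p ∈ P, A p ≠ ⊥ := by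
    intro p hp h
    have := hA p hp
    rw [h, Ideal.mul_bot, eq_comm, Ideal.span_singleton_eq_bot] at this
    exact (hmem p hp).2.2 this
  have hyA : ∀ p ∈ P, Ideal.absNorm (Ideal.span {y p}) =
      Ideal.absNorm J * Ideal.absNorm (A p) := fun p hp =>
    absNorm_span_eq_mul_absNorm (hb _ (hmem p hp).1) (hab _ (hmem p hp).1) (hA p hp) (hy p hp)
  have hybox : ∀ p ∈ P, y p ∈ idealBox J fun _ => Real.toNNReal (T ^ finrank F L) := fun p hp =>
    mem_idealBox_of_mul_eq_mul_intNorm hT.le (ha _ (hmem p hp).1) (hb _ (hmem p hp).1)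
      (hmem p hp).2.1 (hmem p hp).2.2 (hyJ p hp) (hy p hp)
  have hAX : ∀ p ∈ P, (Ideal.absNorm (A p) : ℝ) ≤ X := by
    intro p hp
    have h1 : (Ideal.absNorm (Ideal.span {y p}) : ℝ) ≤ T ^ finrank ℚ L := by
      rw [← prod_pow_mult_eq_absNorm_span, ← finrank_mul_finrank ℚ F L, mul_comm, pow_mul,
        ← sum_mult_eq, ← Finset.prod_pow_eq_pow_sum]
      refine Finset.prod_le_prod (fun _ _ => by positivity) fun w _ => ?_
      have := ((hybox p hp).2 w).le
      rw [Real.coe_toNNReal _ (by positivity)] at this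
      gcongr
    rw [hyA p hp, hTX, Nat.cast_mul, mul_comm] at h1
    exact le_of_mul_le_mul_right h1 (by positivity)
  set Y := (finite_idealBox J fun _ => Real.toNNReal (T ^ finrank F L)).toFinset with hY
  have hYcard : (idealBox J fun _ => Real.toNNReal (T ^ finrank F L)).ncard = Y.card :=
    Set.ncard_eq_toFinset_card _ _
  rw [hYcard]
  refine Finset.card_le_card_mul_of_card_fiber_le (g := y) (fun p hp => by
    simpa [hY] using hybox p hp) fun z _ => ?_
  rcases Finset.eq_empty_or_nonempty {p ∈ P | y p = z} with hempty | ⟨p₀, hp₀⟩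
  · rw [hempty]; simp; positivity
  rw [Finset.mem_filter] at hp₀
  set M := Ideal.absNorm (A p₀) with hM
  have hM0 : M ≠ 0 := by simpa [hM, Ideal.absNorm_eq_zero_iff] using hA0 p₀ hp₀.1
  have hMA : ∀ p ∈ P, y p = z → Ideal.absNorm (A p) = M := by
    intro p hp hpz
    have h1 := hyA p hp
    rw [hpz, ← hp₀.2, hyA p₀ hp₀.1] at h1
    exact (Nat.eq_of_mul_eq_mul_left (Nat.pos_of_ne_zero hJ0) h1).symm
  obtain ⟨hDfin, hDcard⟩ := hdiv (Ideal.span {(M : 𝓞 L)}) (by simpa using hM0)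
  have hMnorm : Ideal.absNorm (Ideal.span {(M : 𝓞 L)}) = M ^ finrank ℚ L := by
    rw [Ideal.absNorm_span_natCast, RingOfIntegers.rank]
  rw [hMnorm, Set.ncard_eq_toFinset_card _ hDfin] at hDcard
  push_cast at hDcard
  have hstep : ((({p ∈ P | y p = z} : Finset _).card : ℕ) : ℝ) ≤
      hDfin.toFinset.card * (C₂ * X ^ ε) := by
    refine Finset.card_le_card_mul_of_card_fiber_le (g := A) (fun p hp => ?_) fun D _ => ?_
    · rw [Finset.mem_filter] at hp
      rw [Set.Finite.mem_toFinset]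
      refine Ideal.dvd_span_singleton.2 ?_
      rw [← hMA p hp.1 hp.2]
      exact Ideal.absNorm_mem _
    rw [Finset.filter_filter]
    rcases Finset.eq_empty_or_nonempty {p ∈ P | y p = z ∧ A p = D} with hempty | ⟨q, hq⟩
    · rw [hempty]; simp; positivity
    rw [Finset.mem_filter] at hq
    obtain ⟨hqP, -, rfl⟩ := hq
    have hfst : ∀ p ∈ P, A p = A q → p.1 = q.1 := by
      have hone : ∀ p ∈ P, A p = A q → p.1 *
          ClassGroup.mk0 ⟨A q, mem_nonZeroDivisors_of_ne_zero (hA0 q hqP)⟩ = 1 := by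
        intro p hp hpq
        rw [← hI p.1, ← map_mul, ClassGroup.mk0_eq_one_iff]
        refine ⟨p.2, ?_⟩
        rw [← Ideal.span, ← hA p hp, hpq]
        rfl
      intro p hp hpq
      exact mul_right_cancel ((hone p hp hpq).trans (hone q hqP rfl).symm)
    set S : Set (𝓞 L) := {x | x ∈ B q.1 ∧ (I q.1 : Ideal (𝓞 L)) * A q = Ideal.span {x}} with hS
    have hSu := hunit (fun v => twistedBox T (a q.1) (b q.1) v) X S hX (fun x hx => hx.1.2)
      (fun x hx v => (hx.1.1.2 v).le) (fun x hx => ?_) (fun x hx x' hx' => ?_)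
    · refine le_trans ?_ hSu.2
      rw [Set.ncard_eq_toFinset_card _ hSu.1]
      refine Nat.cast_le.2 (Finset.card_le_card_of_injOn (fun p => p.2) (fun p hp => ?_) ?_)
      · simp only [Finset.coe_filter, Set.mem_ofPred_eq] at hp
        obtain ⟨hpP, -, hpA⟩ := hp
        have h1 := hfst p hpP hpA
        have h2 := hmem p hpP
        have h3 := hA p hpP
        rw [hpA, h1] at h3
        rw [h1] at h2
        simp only [Set.Finite.coe_toFinset]
        exact ⟨⟨h2.2.1, h2.2.2⟩, h3⟩
      · intro p hp p' hp' hpp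
        simp only [Finset.coe_filter, Set.mem_ofPred_eq] at hp hp'
        refine Sigma.ext ?_ (heq_of_eq hpp)
        rw [hfst p hp.1 hp.2.2, hfst p' hp'.1 hp'.2.2]
    · rw [prod_twistedBox hT.le, hTX, prod_pow_mult_eq_absNorm_span, ← hx.2]
      have hqs := (hmem q hqP).1
      have h1 := congrArg (fun K => (Ideal.absNorm K : ℝ)) (hab q.1 hqs)
      simp only [map_mul, Ideal.absNorm_relNorm, Nat.cast_mul] at h1
      have ha0 : (Ideal.absNorm (Ideal.span {a q.1}) : ℝ) ≠ 0 := by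
        simpa [Ideal.absNorm_eq_zero_iff] using ha q.1 hqs
      have hA1 : (1 : ℝ) ≤ Ideal.absNorm (A q) := by
        rw [Nat.one_le_cast, Nat.one_le_iff_ne_zero, Ne, Ideal.absNorm_eq_zero_iff]
        exact hA0 q hqP
      calc _ = X * Ideal.absNorm (I q.1 : Ideal (𝓞 L)) := by
            field_simp
            linarith
        _ ≤ X * (Ideal.absNorm (I q.1 : Ideal (𝓞 L)) * Ideal.absNorm (A q)) := by
            gcongr
            exact le_mul_of_one_le_right (by positivity) hA1
        _ = _ := by rw [map_mul, Nat.cast_mul]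
    · rw [← Ideal.span_singleton_eq_span_singleton, ← hx.2, ← hx'.2]
  refine hstep.trans ?_
  gcongr
  refine hDcard.trans ?_
  gcongr
  exact hAX p₀ hp₀.1

theorem le_ncard_idealBox_twistedBox_diff {X T : ℝ} (hT : 0 ≤ T) {I : Ideal (𝓞 L)}
    {J : Ideal (𝓞 F)} (hI : I ≠ ⊥) {a b : 𝓞 F} (ha : a ≠ 0)
    (hab : Ideal.span {a} * Ideal.relNorm (𝓞 F) I = Ideal.span {b} * J)
    (hTX : T ^ finrank ℚ L = X * Ideal.absNorm J)
    (hX : 2 * 2 ^ finrank ℚ L * √|(discr L : ℝ)| ≤ X) :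
    X / (2 * 2 ^ finrank ℚ L * √|(discr L : ℝ)|) ≤
      ((idealBox I (twistedBox T a b) \ {0}).ncard : ℝ) := by
  have hD : 0 < √|(discr L : ℝ)| := Real.sqrt_pos.2 (zero_lt_one.trans_le one_le_abs_discr)
  have h := prod_le_mul_ncard_idealBox hI (twistedBox T a b)
  have hNI : (0 : ℝ) < Ideal.absNorm I := by
    rw [Nat.cast_pos, Nat.pos_iff_ne_zero, Ne, Ideal.absNorm_eq_zero_iff]; exact hI
  have hprod : ∏ v : InfinitePlace L, (twistedBox T a b v : ℝ) ^ v.mult = X * Ideal.absNorm I := by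
    have h1 := congrArg (fun K => (Ideal.absNorm K : ℝ)) hab
    simp only [map_mul, Ideal.absNorm_relNorm, Nat.cast_mul] at h1
    have ha0 : (Ideal.absNorm (Ideal.span {a}) : ℝ) ≠ 0 := by
      simpa [Ideal.absNorm_eq_zero_iff] using ha
    rw [prod_twistedBox hT, hTX]
    field_simp
    linear_combination (-X) * h1
  rw [hprod] at h
  have hle : X ≤ 2 ^ finrank ℚ L * √|(discr L : ℝ)| * (idealBox I (twistedBox T a b)).ncard :=
    le_of_mul_le_mul_right (by linarith) hNI
  have hsub : ((idealBox I (twistedBox T a b)).ncard : ℝ) - 1 ≤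
      (idealBox I (twistedBox T a b) \ {0}).ncard := by
    have := Set.le_ncard_sdiff {0} (idealBox I (twistedBox T a b)) (Set.finite_singleton 0)
    rw [Set.ncard_singleton] at this
    rw [sub_le_iff_le_add]
    exact_mod_cast tsub_le_iff_right.1 this
  refine le_trans ?_ hsub
  rw [div_le_iff₀ (by positivity)]
  set P := 2 ^ finrank ℚ L * √|(discr L : ℝ)|
  nlinarith

/-- The class of the relative norm of a nonzero ideal. -/
noncomputable def relNormClass (F : Type*) [Field F] [NumberField F] [Algebra F L]
    (I : (Ideal (𝓞 L))⁰) : ClassGroup (𝓞 F) :=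
  ClassGroup.mk0 ⟨Ideal.relNorm (𝓞 F) (I : Ideal (𝓞 L)), mem_nonZeroDivisors_of_ne_zero fun h =>
    nonZeroDivisors.coe_ne_zero I (Ideal.relNorm_eq_bot_iff.1 h)⟩

theorem card_mul_sqrt_le {ε C₁ C₂ X : ℝ} (hε : 0 < ε) (hC₁ : 0 < C₁)
    (hC₂ : 0 < C₂) (hX : 1 ≤ X)
    (hdiv : ∀ I : Ideal (𝓞 L), I ≠ 0 → {A | A ∣ I}.Finite ∧
      ({A | A ∣ I}.ncard : ℝ) ≤ C₁ * (Ideal.absNorm I : ℝ) ^ ε)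
    (hunit : ∀ (f : InfinitePlace L → ℝ) (X : ℝ) (S : Set (𝓞 L)), 1 ≤ X → (∀ x ∈ S, x ≠ 0) →
      (∀ x ∈ S, ∀ w : InfinitePlace L, w (x : L) ≤ f w) →
      (∀ x ∈ S, ∏ w, f w ^ w.mult ≤ X * ∏ w : InfinitePlace L, w (x : L) ^ w.mult) →
      (∀ x ∈ S, ∀ y ∈ S, Associated x y) → S.Finite ∧ (S.ncard : ℝ) ≤ C₂ * X ^ ε)
    {J : (Ideal (𝓞 F))⁰}
    (hXL : 2 * 2 ^ finrank ℚ L * √|(discr L : ℝ)| ≤ X)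
    (hXF : (finrank ℚ F * (Ideal.absNorm (J : Ideal (𝓞 F)) *
      (2 ^ (finrank ℚ F + 2) * √|(discr F : ℝ)|) ^ finrank ℚ F)) ^ finrank ℚ F < X)
    (s : Finset (ClassGroup (𝓞 L))) (I : ClassGroup (𝓞 L) → (Ideal (𝓞 L))⁰)
    (hI : ∀ c, ClassGroup.mk0 (I c) = c)
    (hs : ∀ c ∈ s, relNormClass F (I c) = ClassGroup.mk0 J) :
    s.card * √|(discr F : ℝ)| ≤ 2 * 2 ^ finrank ℚ L * √|(discr L : ℝ)| *
      (16 ^ finrank ℚ F * ((C₁ * (X ^ finrank ℚ L) ^ ε) * (C₂ * X ^ ε))) := by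
  have hJ : (J : Ideal (𝓞 F)) ≠ ⊥ := nonZeroDivisors.coe_ne_zero J
  have hD : 0 < √|(discr L : ℝ)| := Real.sqrt_pos.2 (zero_lt_one.trans_le one_le_abs_discr)
  have hNJ : (1 : ℝ) ≤ Ideal.absNorm (J : Ideal (𝓞 F)) := by
    rw [Nat.one_le_cast, Nat.one_le_iff_ne_zero, Ne, Ideal.absNorm_eq_zero_iff]; exact hJ
  have hd : finrank ℚ L ≠ 0 := finrank_pos.ne'
  have hX0 : 0 < X := by linarith
  set T : ℝ := (X * Ideal.absNorm (J : Ideal (𝓞 F))) ^ (finrank ℚ L : ℝ)⁻¹ with hTdef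
  have hT : 0 < T := by positivity
  have hTX : T ^ finrank ℚ L = X * Ideal.absNorm (J : Ideal (𝓞 F)) :=
    Real.rpow_inv_natCast_pow (by positivity) hd
  have hex : ∀ c ∈ s, ∃ a b : 𝓞 F, a ≠ 0 ∧ b ≠ 0 ∧
      Ideal.span {a} * Ideal.relNorm (𝓞 F) (I c : Ideal (𝓞 L)) = Ideal.span {b} * J := by
    intro c hc
    obtain ⟨a, b, ha, hb, h⟩ := (ClassGroup.mk0_eq_mk0_iff ..).1 (hs c hc)
    exact ⟨a, b, ha, hb, h⟩
  choose! a b ha hb hab using hex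
  have hsum := sum_ncard_idealBox_twistedBox_le hε hC₁ hC₂ hX hT hdiv hunit hJ hTX s I hI a b
    ha hb hab
  have hlow : s.card * (X / (2 * 2 ^ finrank ℚ L * √|(discr L : ℝ)|)) ≤
      ∑ c ∈ s, ((idealBox (I c : Ideal (𝓞 L)) (twistedBox T (a c) (b c)) \ {0}).ncard : ℝ) := by
    rw [← nsmul_eq_mul]
    exact Finset.card_nsmul_le_sum _ _ _ fun c hc => le_ncard_idealBox_twistedBox_diff hT.le
      (nonZeroDivisors.coe_ne_zero (I c)) (ha c hc) (hab c hc) hTX hXL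
  have hTm : (T ^ finrank F L) ^ finrank ℚ F = X * Ideal.absNorm (J : Ideal (𝓞 F)) := by
    rw [← pow_mul, mul_comm, finrank_mul_finrank ℚ F L, hTX]
  have hup := ncard_idealBox_mul_le_of_lt hJ (fun _ => Real.toNNReal (T ^ finrank F L))
    fun _ => by
      rw [Real.coe_toNNReal _ (by positivity)]
      refine lt_of_pow_lt_pow_left₀ (finrank ℚ F) (by positivity) ?_
      rw [hTm]
      exact hXF.trans_le (le_mul_of_one_le_right hX0.le hNJ)
  rw [Real.coe_toNNReal _ (by positivity), Finset.prod_pow_eq_pow_sum, sum_mult_eq, hTm] at hup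
  set n := ((idealBox (J : Ideal (𝓞 F)) fun _ => Real.toNNReal (T ^ finrank F L)).ncard : ℝ)
  have hup' : n * √|(discr F : ℝ)| ≤ 16 ^ finrank ℚ F * X :=
    le_of_mul_le_mul_right (by linarith) (zero_lt_one.trans_le hNJ)
  set R := (C₁ * (X ^ finrank ℚ L) ^ ε) * (C₂ * X ^ ε)
  have hR : 0 ≤ R := by positivity
  have hfin := mul_le_mul_of_nonneg_right (hlow.trans hsum) (Real.sqrt_nonneg |(discr F : ℝ)|)
  have hfin' : s.card * (X / (2 * 2 ^ finrank ℚ L * √|(discr L : ℝ)|)) * √|(discr F : ℝ)| ≤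
      16 ^ finrank ℚ F * X * R :=
    hfin.trans (by nlinarith [mul_le_mul_of_nonneg_right hup' hR])
  refine le_of_mul_le_mul_right ?_ hX0
  rw [mul_div_assoc', div_mul_eq_mul_div, div_le_iff₀ (by positivity)] at hfin'
  linarith

variable (F L) in
theorem finrank_rat_le_finrank_rat : finrank ℚ F ≤ finrank ℚ L := by
  rw [← finrank_mul_finrank ℚ F L]
  exact Nat.le_mul_of_pos_right _ finrank_pos

theorem abs_discr_le_abs_discr (F L : Type*) [Field F] [NumberField F] [Field L] [NumberField L]
    [Algebra F L] : |(discr F : ℝ)| ≤ |(discr L : ℝ)| := by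
  exact_mod_cast Int.le_of_dvd (abs_pos.2 (discr_ne_zero L))
    ((abs_dvd_abs _ _).2 (discr_dvd_discr F L))

/-- In an extension of number fields `L / F`, the relative norm on ideal classes has fibres of size
`O(|discr L| ^ (1 / 2 + ε) / |discr F| ^ (1 / 2))`, uniformly for `L` of given degree. -/
theorem exists_card_mul_sqrt_abs_discr_le (d : ℕ) {ε : ℝ} (hε : 0 < ε) : ∃ C : ℝ, 0 < C ∧
    ∀ (F L : Type*) [Field F] [NumberField F] [Field L] [NumberField L] [Algebra F L],
      finrank ℚ L = d → ∀ (c' : ClassGroup (𝓞 F)) (s : Finset (ClassGroup (𝓞 L)))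
        (I : ClassGroup (𝓞 L) → (Ideal (𝓞 L))⁰), (∀ c, ClassGroup.mk0 (I c) = c) →
        (∀ c ∈ s, relNormClass F (I c) = c') →
        s.card * √|(discr F : ℝ)| ≤ C * |(discr L : ℝ)| ^ ((1 : ℝ) / 2 + ε) := by
  rcases Nat.eq_zero_or_pos d with rfl | hd
  · refine ⟨1, one_pos, fun F L _ _ _ _ _ hL => absurd hL finrank_pos.ne'⟩
  have hd1 : (1 : ℝ) ≤ d := by exact_mod_cast hd
  set E : ℕ := (d + 1) * d with hE
  set η : ℝ := ε / ((d + 1) * (E + 1)) with hη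
  have hη0 : 0 < η := by positivity
  obtain ⟨C₁, hC₁, hdiv⟩ := exists_ncard_dvd_ideal_le d hη0
  obtain ⟨C₂, hC₂, hunit⟩ := exists_ncard_associated_le d hη0
  set κ : ℝ := 2 * d ^ d * (2 ^ (d + 2)) ^ E with hκ
  have hκ0 : 0 < κ := by positivity
  refine ⟨2 * 2 ^ d * 16 ^ d * C₁ * C₂ * κ ^ ((d + 1) * η), by positivity, ?_⟩
  intro F L _ _ _ _ _ hL c' s I hI hs
  have hm : finrank ℚ F ≤ d := hL ▸ finrank_rat_le_finrank_rat F L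
  have hDF : (1 : ℝ) ≤ |(discr F : ℝ)| := one_le_abs_discr
  have hFL := abs_discr_le_abs_discr F L
  set D := |(discr L : ℝ)| with hD
  have hD1 : 1 ≤ D := hDF.trans hFL
  have hsqrt : ∀ {x : ℝ}, 1 ≤ x → √x ≤ x := fun {x} hx =>
    Real.sqrt_le_iff.2 ⟨by linarith, by nlinarith⟩
  set Z : ℝ := 2 ^ (d + 2) * D with hZ
  have hZ1 : 1 ≤ Z := one_le_mul_of_one_le_of_one_le (one_le_pow₀ (by norm_num)) hD1
  set X : ℝ := κ * D ^ E with hXdef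
  have hXZ : X = 2 * (d ^ d * Z ^ E) := by rw [hXdef, hκ, hZ, mul_pow]; ring
  have hdd : (1 : ℝ) ≤ d ^ d := one_le_pow₀ hd1
  have hZX : 2 * Z ≤ X := by
    rw [hXZ]
    gcongr
    calc Z = 1 * Z ^ 1 := by ring
      _ ≤ d ^ d * Z ^ E := by
        gcongr
        exact Nat.mul_pos d.succ_pos hd
  obtain ⟨J, rfl, hJ⟩ := exists_mk0_eq_absNorm_le c'
  have hDFZ : 2 ^ (finrank ℚ F + 2) * √|(discr F : ℝ)| ≤ Z := by
    rw [hZ]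
    gcongr
    · norm_num
    · exact (hsqrt hDF).trans hFL
  have hJZ : (Ideal.absNorm (J : Ideal (𝓞 F)) : ℝ) ≤ Z := by
    refine hJ.trans (le_trans ?_ hDFZ)
    gcongr
    · norm_num
    · omega
  have hXF : (finrank ℚ F * (Ideal.absNorm (J : Ideal (𝓞 F)) *
      (2 ^ (finrank ℚ F + 2) * √|(discr F : ℝ)|) ^ finrank ℚ F)) ^ finrank ℚ F < X := by
    have hb : (1 : ℝ) ≤ d * (Z * Z ^ d) := one_le_mul_of_one_le_of_one_le hd1
      (one_le_mul_of_one_le_of_one_le hZ1 (one_le_pow₀ hZ1))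
    calc _ ≤ (d * (Z * Z ^ finrank ℚ F)) ^ finrank ℚ F := by gcongr
      _ ≤ (d * (Z * Z ^ d)) ^ finrank ℚ F := by gcongr
      _ ≤ (d * (Z * Z ^ d)) ^ d := pow_le_pow_right₀ hb hm
      _ = d ^ d * Z ^ E := by rw [← pow_succ', mul_pow, ← pow_mul]
      _ < X := by
        rw [hXZ]
        have : (0 : ℝ) < d ^ d * Z ^ E := by positivity
        linarith
  have hX0 : 0 < X := by positivity
  have hmain := card_mul_sqrt_le hη0 hC₁ hC₂ (by linarith) (hdiv L hL) (hunit L hL)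
    (J := J) (by
      refine le_trans ?_ hZX
      rw [hL, hZ, mul_assoc]
      gcongr
      · norm_num
      · omega
      · exact hsqrt hD1) hXF s I hI hs
  rw [hL] at hmain
  have hpow : (X ^ d) ^ η * X ^ η ≤ κ ^ ((d + 1) * η) * D ^ ε := by
    have h1 : (X ^ d) ^ η * X ^ η = X ^ ((d + 1) * η) := by
      rw [← Real.mul_rpow (by positivity) hX0.le, ← pow_succ, Real.rpow_mul hX0.le]
      exact_mod_cast rfl
    rw [h1, hXdef, Real.mul_rpow hκ0.le (by positivity), ← Real.rpow_natCast D E,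
      ← Real.rpow_mul (by positivity)]
    gcongr
    rw [hη]
    calc _ = ε * (E / (E + 1)) := by field_simp
      _ ≤ ε * 1 := by
        gcongr
        exact div_le_one_of_le₀ (by linarith) (by positivity)
      _ = ε := mul_one ε
  calc _ ≤ 2 * 2 ^ d * √D * (16 ^ finrank ℚ F * ((C₁ * (X ^ d) ^ η) * (C₂ * X ^ η))) := hmain
    _ = 2 * 2 ^ d * √D * (16 ^ finrank ℚ F * (C₁ * C₂ * ((X ^ d) ^ η * X ^ η))) := by ring
    _ ≤ 2 * 2 ^ d * √D * (16 ^ d * (C₁ * C₂ * (κ ^ ((d + 1) * η) * D ^ ε))) := by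
        gcongr
        norm_num
    _ = _ := by
        rw [Real.rpow_add (by linarith), Real.sqrt_eq_rpow]
        ring

theorem relNormClass_pow_eq_one {I : (Ideal (𝓞 L))⁰} {ℓ : ℕ} (h : ClassGroup.mk0 I ^ ℓ = 1) :
    relNormClass F I ^ ℓ = 1 := by
  rw [← map_pow, ClassGroup.mk0_eq_one_iff] at h
  rw [relNormClass, ← map_pow, ClassGroup.mk0_eq_one_iff]
  obtain ⟨x, hx⟩ := h
  refine ⟨Algebra.intNorm (𝓞 F) (𝓞 L) x, ?_⟩
  have hx' : (I : Ideal (𝓞 L)) ^ ℓ = Ideal.span {x} := by simpa using hx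
  have := congrArg (Ideal.relNorm (𝓞 F)) hx'
  rw [map_pow, Ideal.relNorm_singleton] at this
  simpa using this

end NumberField

theorem ellTorsion_mul_sqrt_le_of_fiber (ℓ : ℕ) {F L : Type*} [Field F] [NumberField F] [Field L]
    [NumberField L] [Algebra F L] {B : ℝ}
    (hB : ∀ (c' : ClassGroup (𝓞 F)) (s : Finset (ClassGroup (𝓞 L)))
      (I : ClassGroup (𝓞 L) → nonZeroDivisors (Ideal (𝓞 L))), (∀ c, ClassGroup.mk0 (I c) = c) →
      (∀ c ∈ s, relNormClass F (I c) = c') → (s.card : ℝ) ≤ B) :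
    (ellTorsion L ℓ : ℝ) ≤ ellTorsion F ℓ * B := by
  classical
  set I := Function.surjInv (ClassGroup.mk0_surjective (R := 𝓞 L))
  have hI : ∀ c, ClassGroup.mk0 (I c) = c := Function.surjInv_eq _
  have key := Finset.card_le_card_mul_of_card_fiber_le
    (s := ({c | c ^ ℓ = 1} : Finset (ClassGroup (𝓞 L))))
    (t := ({c | c ^ ℓ = 1} : Finset (ClassGroup (𝓞 F))))
    (g := fun c => relNormClass F (I c)) (B := B) (fun c hc => by
      simp only [Finset.mem_filter, Finset.mem_univ, true_and] at hc ⊢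
      exact relNormClass_pow_eq_one ((congrArg (· ^ ℓ) (hI c)).trans hc))
    fun c' _ => hB c' _ I hI fun c hc => (Finset.mem_filter.1 hc).2
  simpa [ellTorsion, Nat.card_eq_fintype_card, Fintype.card_subtype] using key

/-- Suppose a pointwise saving `δ` on `ℓ`-torsion holds for Galois number
fields with group `G`. Then for every `ε > 0` there is `C' > 0` such that for every tower
`ℚ ⊆ F ⊆ L` with `[L : ℚ] = d` and `F/ℚ` Galois with group `G`,
`|Cl_L[ℓ]| ≤ C' · Disc(L)^(1/2+ε) · Disc(F)^(-δ)`. -/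
theorem ltorsion_bound_in_tower (ℓ : ℕ) (hℓ : 1 < ℓ)
    (G : Type) [Group G] [Finite G] (δ : ℝ) (hδ : 0 < δ) (d : ℕ) (hd : 1 ≤ d)
    (hG : ∀ ε : ℝ, 0 < ε → ∃ C : ℝ, 0 < C ∧
      ∀ (F : Type) [Field F] [NumberField F] [IsGalois ℚ F],
        Nonempty ((F ≃ₐ[ℚ] F) ≃* G) →
        (ellTorsion F ℓ : ℝ) ≤ C * (|discr F| : ℝ) ^ ((1 : ℝ) / 2 - δ + ε)) :
    ∀ ε : ℝ, 0 < ε → ∃ C' : ℝ, 0 < C' ∧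
      ∀ (F L : Type) [Field F] [NumberField F] [Field L] [NumberField L]
        [Algebra F L] [IsScalarTower ℚ F L] [IsGalois ℚ F],
        Module.finrank ℚ L = d →
        Nonempty ((F ≃ₐ[ℚ] F) ≃* G) →
        (ellTorsion L ℓ : ℝ) ≤
          C' * (|discr L| : ℝ) ^ ((1 : ℝ) / 2 + ε) * (|discr F| : ℝ) ^ (-δ) := by
  intro ε hε
  obtain ⟨C, hC, hF⟩ := hG (ε / 2) (half_pos hε)
  obtain ⟨C', hC', hfib⟩ := exists_card_mul_sqrt_abs_discr_le d (half_pos hε)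
  refine ⟨C * C', mul_pos hC hC', ?_⟩
  intro F L _ _ _ _ _ _ _ hL hiso
  have hDF : (1 : ℝ) ≤ |(discr F : ℝ)| := one_le_abs_discr
  have hFL := abs_discr_le_abs_discr F L
  have hs : 0 < √|(discr F : ℝ)| := Real.sqrt_pos.2 (by linarith)
  have h := ellTorsion_mul_sqrt_le_of_fiber ℓ (F := F) (L := L)
    (B := C' * |(discr L : ℝ)| ^ ((1 : ℝ) / 2 + ε / 2) / √|(discr F : ℝ)|)
    fun c' s I hI hc => (le_div_iff₀ hs).2 (hfib F L hL c' s I hI hc)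
  have hF' := hF F hiso
  set x := |(discr F : ℝ)|
  set y := |(discr L : ℝ)|
  have hx0 : 0 < x := by linarith
  have hy0 : 0 < y := by linarith
  calc (ellTorsion L ℓ : ℝ)
      ≤ (C * x ^ ((1 : ℝ) / 2 - δ + ε / 2)) * (C' * y ^ ((1 : ℝ) / 2 + ε / 2) / √x) := by
        refine h.trans ?_
        gcongr
    _ = C * C' * (x ^ (ε / 2) * y ^ ((1 : ℝ) / 2 + ε / 2)) * x ^ (-δ) := by
        rw [show (1 : ℝ) / 2 - δ + ε / 2 = 1 / 2 + (ε / 2 + -δ) by ring, Real.rpow_add hx0,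
          Real.rpow_add hx0, Real.sqrt_eq_rpow]
        field_simp
    _ ≤ C * C' * (y ^ (ε / 2) * y ^ ((1 : ℝ) / 2 + ε / 2)) * x ^ (-δ) := by gcongr
    _ = C * C' * y ^ ((1 : ℝ) / 2 + ε) * x ^ (-δ) := by
        rw [← Real.rpow_add hy0]
        ring_nf
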